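/- Suppose the weight function w is symmetric and belongs to Γ(r,Δ) for some r > 0 and Δ > 0, and x is a solution of the opinion dynamics. Then there exist an integer k ≥ 1 and points z_1, …, z_k ∈ [0,1] with |z_i − z_j| ≥ r for all i ≠ j, such that for Lebesgue-almost every α ∈ [0,1], the limit lim_{t→∞} x_t(α) exists and belongs to {z_1, …, z_k}. -/

import Mathlib

open MeasureTheory Filter Set Topology

/-- The interaction field at time `t` for agent `α`:
`∫_0^1 w(t,α,β,x_t(α),x_t(β)) · (x_t(β) − x_t(α)) dβ`. -/
noncomputable def interactionField (w : ℝ → ℝ → ℝ → ℝ → ℝ → ℝ) (x : ℝ → ℝ → ℝ)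
    (t α : ℝ) : ℝ :=
  ∫ β in (0:ℝ)..1, w t α β (x t α) (x t β) * (x t β - x t α)

/-- `f` is absolutely continuous on the compact interval `[a,b]`. -/
def AbsolutelyContinuousOn (f : ℝ → ℝ) (a b : ℝ) : Prop :=
  ∀ ε > 0, ∃ δ > 0, ∀ n : ℕ, ∀ c d : Fin n → ℝ,
    (∀ i, a ≤ c i ∧ c i ≤ d i ∧ d i ≤ b) →
    (Pairwise fun i j => Set.Ioo (c i) (d i) ∩ Set.Ioo (c j) (d j) = ∅) →
    (∑ i, (d i - c i)) < δ → (∑ i, |f (d i) - f (c i)|) < ε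

/-- `w` is an admissible weight function: jointly Borel measurable, nonnegative and
bounded by `W` on the domain `[0,∞) × [0,1] × [0,1] × ℝ × ℝ`. -/
structure IsWeight (W : ℝ) (w : ℝ → ℝ → ℝ → ℝ → ℝ → ℝ) : Prop where
  measurable : Measurable fun p : ℝ × ℝ × ℝ × ℝ × ℝ =>
    w p.1 p.2.1 p.2.2.1 p.2.2.2.1 p.2.2.2.2
  nonneg : ∀ t, 0 ≤ t → ∀ α ∈ Icc (0:ℝ) 1, ∀ β ∈ Icc (0:ℝ) 1, ∀ a b : ℝ,
    0 ≤ w t α β a b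
  le_bound : ∀ t, 0 ≤ t → ∀ α ∈ Icc (0:ℝ) 1, ∀ β ∈ Icc (0:ℝ) 1, ∀ a b : ℝ,
    w t α β a b ≤ W

/-- `x` is a solution of the opinion dynamics with weight function `w`:
measurable in the agent, absolutely continuous in time on compact intervals,
with initial opinions in `[0,1]`, locally bounded, and for each agent satisfying
the ODE `(d/dt) x_t(α) = ∫_0^1 w(t,α,β,x_t(α),x_t(β))·(x_t(β) − x_t(α)) dβ`
for almost every `t ≥ 0`. -/
structure IsSolution (w : ℝ → ℝ → ℝ → ℝ → ℝ → ℝ) (x : ℝ → ℝ → ℝ) : Prop where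
  meas : ∀ t, 0 ≤ t → Measurable (x t)
  absCont : ∀ α ∈ Icc (0:ℝ) 1, ∀ T, 0 ≤ T → AbsolutelyContinuousOn (fun t => x t α) 0 T
  init_mem : ∀ α ∈ Icc (0:ℝ) 1, x 0 α ∈ Icc (0:ℝ) 1
  locBdd : ∀ T, 0 ≤ T → ∃ M : ℝ, ∀ α ∈ Icc (0:ℝ) 1, ∀ t ∈ Icc (0:ℝ) T, |x t α| ≤ M
  ode : ∀ α ∈ Icc (0:ℝ) 1, ∀ᵐ t ∂(volume.restrict (Ici (0:ℝ))),
    HasDerivAt (fun s => x s α) (interactionField w x t α) t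

/-- The weight function is symmetric. -/
def SymmetricWeight (w : ℝ → ℝ → ℝ → ℝ → ℝ → ℝ) : Prop :=
  ∀ t α β a b, w t α β a b = w t β α b a

/-- `w ∈ Γ(r,Δ)`: the weight is at least `Δ` whenever the two opinions are within `r`. -/
def InGamma (r Δ : ℝ) (w : ℝ → ℝ → ℝ → ℝ → ℝ → ℝ) : Prop :=
  ∀ t, 0 ≤ t → ∀ α ∈ Icc (0:ℝ) 1, ∀ β ∈ Icc (0:ℝ) 1, ∀ a b : ℝ,
    |a - b| ≤ r → Δ ≤ w t α β a b

/-- The opinion distribution `μ_t`: pushforward of Lebesgue measure on `[0,1]` by `x_t`. -/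
noncomputable def opinionMeasure (x : ℝ → ℝ → ℝ) (t : ℝ) : Measure ℝ :=
  (volume.restrict (Icc (0:ℝ) 1)).map (x t)

/-- The order of the opinions is preserved: if agent `β`'s opinion is strictly above
agent `α`'s at some time, it is strictly above at every time. -/
def OrderPreserved (x : ℝ → ℝ → ℝ) : Prop :=
  ∀ α ∈ Icc (0:ℝ) 1, ∀ β ∈ Icc (0:ℝ) 1, ∀ s, 0 ≤ s → ∀ t, 0 ≤ t →
    x t α < x t β → x s α < x s β


theorem AbsolutelyContinuousOn.absolutelyContinuousOnInterval {f : ℝ → ℝ} {a b : ℝ}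
    (hab : a ≤ b) (hf : AbsolutelyContinuousOn f a b) : AbsolutelyContinuousOnInterval f a b := by
  rw [absolutelyContinuousOnInterval_iff]
  intro ε hε
  obtain ⟨δ, hδ, h⟩ := hf ε hε
  refine ⟨δ, hδ, fun E hE hlen => ?_⟩
  obtain ⟨hmem, hdisj⟩ := hE
  have hlen_eq : ∀ i, max (E.2 i).1 (E.2 i).2 - min (E.2 i).1 (E.2 i).2
      = dist (E.2 i).1 (E.2 i).2 := fun i => by
    rw [max_sub_min_eq_abs', Real.dist_eq]
  have hval_eq : ∀ i, |f (max (E.2 i).1 (E.2 i).2) - f (min (E.2 i).1 (E.2 i).2)|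
      = dist (f (E.2 i).1) (f (E.2 i).2) := fun i => by
    rcases le_total (E.2 i).1 (E.2 i).2 with hle | hle
    · rw [max_eq_right hle, min_eq_left hle, dist_comm, Real.dist_eq]
    · rw [max_eq_left hle, min_eq_right hle, Real.dist_eq]
  have key := h E.1 (fun i => min (E.2 i).1 (E.2 i).2) (fun i => max (E.2 i).1 (E.2 i).2)
    (fun i => by
      have := hmem i (Finset.mem_range.2 i.2)
      rw [uIcc_of_le hab] at this
      exact ⟨le_min this.1.1 this.2.1, min_le_max, max_le this.1.2 this.2.2⟩)
    (fun i j hij => by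
      have := hdisj (Finset.mem_coe.2 (Finset.mem_range.2 i.2))
        (Finset.mem_coe.2 (Finset.mem_range.2 j.2)) (fun h => hij (Fin.ext h))
      refine Set.disjoint_iff_inter_eq_empty.1 (this.mono ?_ ?_) <;>
        exact Ioo_subset_Ioc_self)
  simp only [hlen_eq, hval_eq] at key
  rw [Fin.sum_univ_eq_sum_range (fun i => dist (E.2 i).1 (E.2 i).2),
    Fin.sum_univ_eq_sum_range (fun i => dist (f (E.2 i).1) (f (E.2 i).2))] at key
  exact key hlen

theorem continuousOn_Ici_of_absolutelyContinuousOnInterval {f : ℝ → ℝ}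
    (hf : ∀ T, 0 ≤ T → AbsolutelyContinuousOnInterval f 0 T) : ContinuousOn f (Ici 0) := by
  intro t ht
  have ht : 0 ≤ t := ht
  have hc := (hf (t + 1) (by linarith)).continuousOn
  rw [uIcc_of_le (by linarith)] at hc
  refine (hc t ⟨ht, by linarith⟩).mono_of_mem_nhdsWithin ?_
  rw [← Ici_inter_Iic]
  exact inter_mem self_mem_nhdsWithin (mem_nhdsWithin_of_mem_nhds (Iic_mem_nhds (by linarith)))

theorem AbsolutelyContinuousOnInterval.integral_eq_sub_of_ae_hasDerivAt {u v : ℝ → ℝ} {a b : ℝ}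
    (hab : a ≤ b) (hu : AbsolutelyContinuousOnInterval u a b)
    (hv : ∀ᵐ t, t ∈ Icc a b → HasDerivAt u (v t) t) :
    ∫ t in a..b, v t = u b - u a := by
  rw [← hu.integral_deriv_eq_sub]
  refine intervalIntegral.integral_congr_ae ?_
  filter_upwards [hv] with t ht hmem
  rw [uIoc_of_le hab] at hmem
  exact (ht (Ioc_subset_Icc_self hmem)).deriv.symm

theorem AbsolutelyContinuousOnInterval.abs_sub_le_of_ae_hasDerivAt {u v : ℝ → ℝ} {a b C : ℝ}
    (hab : a ≤ b) (hu : AbsolutelyContinuousOnInterval u a b)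
    (hv : ∀ᵐ t, t ∈ Icc a b → HasDerivAt u (v t) t) (hC : ∀ t ∈ Icc a b, |v t| ≤ C) :
    |u b - u a| ≤ C * (b - a) := by
  rw [← hu.integral_eq_sub_of_ae_hasDerivAt hab hv, ← abs_of_nonneg (sub_nonneg.2 hab)]
  refine intervalIntegral.norm_integral_le_of_norm_le_const (f := v) fun t ht => ?_
  rw [uIoc_of_le hab] at ht
  exact hC t (Ioc_subset_Icc_self ht)

theorem AbsolutelyContinuousOnInterval.integral_comp_eq_sub_of_ae_hasDerivAt
    {u v f g : ℝ → ℝ} {a b C : ℝ} (hab : a ≤ b) (hu : AbsolutelyContinuousOnInterval u a b)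
    (hv : ∀ᵐ t, t ∈ Icc a b → HasDerivAt u (v t) t) (hC : ∀ t ∈ Icc a b, |v t| ≤ C)
    (hf : ∀ z, HasDerivAt f (g z) z) (hg : Continuous g) :
    ∫ t in a..b, g (u t) * v t = f (u b) - f (u a) := by
  have hlip : LipschitzOnWith C.toNNReal u (Icc a b) := by
    refine LipschitzOnWith.of_dist_le_mul fun s hs t ht => ?_
    wlog hst : s ≤ t generalizing s t
    · rw [dist_comm, dist_comm s]
      exact this t ht s hs (le_of_not_ge hst)
    have hsub : Icc s t ⊆ Icc a b := Icc_subset_Icc hs.1 ht.2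
    rw [dist_comm, dist_comm s, Real.dist_eq, Real.dist_eq, abs_of_nonneg (sub_nonneg.2 hst)]
    refine ((hu.mono (by rwa [uIcc_of_le hst, uIcc_of_le hab])).abs_sub_le_of_ae_hasDerivAt hst
      (hv.mono fun z hz hmem => hz (hsub hmem)) fun z hz => hC z (hsub hz)).trans ?_
    gcongr
    exact Real.le_coe_toNNReal C
  have hf1 : ContDiff ℝ 1 f := by
    rw [contDiff_one_iff_deriv]
    exact ⟨fun z => (hf z).differentiableAt, by
      rwa [show deriv f = g from funext fun z => (hf z).deriv]⟩
  obtain ⟨M, hM⟩ := hu.exists_bound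
  rw [uIcc_of_le hab] at hM
  obtain ⟨K, hK⟩ := hf1.contDiffOn.exists_lipschitzOnWith (by decide) (convex_Icc (-M) M)
    isCompact_Icc
  have hcomp : AbsolutelyContinuousOnInterval (f ∘ u) a b := by
    apply LipschitzOnWith.absolutelyContinuousOnInterval (K := K * C.toNNReal)
    rw [uIcc_of_le hab]
    exact hK.comp hlip fun t ht => abs_le.1 (hM t ht)
  refine hcomp.integral_eq_sub_of_ae_hasDerivAt hab ?_
  filter_upwards [hv] with t ht hmem
  exact (hf (u t)).comp t (ht hmem)

/-- A Lipschitz function that spends finite time in the annulus `ε ≤ |u - z| ≤ 2ε` eventually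
avoids the middle sphere of that annulus. -/
theorem eventually_ne_of_volume_annulus_lt_top {u : ℝ → ℝ} {z ε T L : ℝ} (hε : 0 < ε) (hL : 0 < L)
    (hu : ∀ s t, T ≤ s → s ≤ t → |u t - u s| ≤ L * (t - s))
    (hmeas : Measurable u)
    (hfin : volume ({t | ε ≤ |u t - z| ∧ |u t - z| ≤ 2 * ε} ∩ Ioi T) < ⊤) :
    ∀ᶠ t in atTop, |u t - z| ≠ 3 / 2 * ε := by
  set S := {t | ε ≤ |u t - z| ∧ |u t - z| ≤ 2 * ε} ∩ Ioi T with hS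
  have hSm : MeasurableSet S := by
    refine MeasurableSet.inter ?_ measurableSet_Ioi
    exact (measurableSet_le measurable_const (hmeas.sub_const z).abs).inter
      (measurableSet_le (hmeas.sub_const z).abs measurable_const)
  have htend : Tendsto (fun n : ℕ => volume (S ∩ Ici (n : ℝ))) atTop (𝓝 0) := by
    have h := tendsto_measure_iInter_atTop (μ := volume) (s := fun n : ℕ => S ∩ Ici (n : ℝ))
      (fun n => (hSm.inter measurableSet_Ici).nullMeasurableSet)
      (fun m n hmn => inter_subset_inter_right _ (Ici_subset_Ici.2 (Nat.cast_le.2 hmn)))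
      ⟨0, ((measure_mono inter_subset_left).trans_lt hfin).ne⟩
    have hempty : ⋂ n : ℕ, S ∩ Ici (n : ℝ) = ∅ := by
      refine eq_empty_of_forall_notMem fun t ht => ?_
      obtain ⟨n, hn⟩ := exists_nat_gt t
      exact absurd (mem_iInter.1 ht n).2 (not_le.2 hn)
    rwa [hempty, measure_empty] at h
  by_contra hcon
  have hfreq : ∃ᶠ t in atTop, |u t - z| = 3 / 2 * ε := by
    simpa only [Filter.not_eventually, ne_eq, not_not] using hcon
  have hpos : 0 < ENNReal.ofReal (ε / (2 * L)) := ENNReal.ofReal_pos.2 (by positivity)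
  obtain ⟨n, hn⟩ := (htend.eventually (gt_mem_nhds hpos)).exists
  obtain ⟨t, ht, htz⟩ := frequently_atTop.1 hfreq (max n (T + 1))
  refine absurd hn (not_lt.2 ?_)
  have hsub : Icc t (t + ε / (2 * L)) ⊆ S ∩ Ici (n : ℝ) := by
    intro s hs
    have hTt : T < t := by linarith [le_max_right (n : ℝ) (T + 1)]
    have h1 := hu t s hTt.le hs.1
    have h2 : L * (s - t) ≤ ε / 2 := by
      calc L * (s - t) ≤ L * (ε / (2 * L)) := by gcongr; linarith [hs.2]
        _ = ε / 2 := by field_simp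
    have h3 : |(|u s - z| - |u t - z|)| ≤ ε / 2 :=
      (abs_abs_sub_abs_le_abs_sub _ _).trans (by
        rw [sub_sub_sub_cancel_right]; exact h1.trans h2)
    rw [abs_le] at h3
    refine ⟨⟨⟨?_, ?_⟩, ?_⟩, ?_⟩
    · linarith
    · linarith
    · exact hTt.trans_le hs.1
    · exact ((le_max_left _ _).trans ht).trans hs.1
  calc ENNReal.ofReal (ε / (2 * L)) = volume (Icc t (t + ε / (2 * L))) := by simp
    _ ≤ _ := measure_mono hsub

theorem eventually_lt_of_frequently_lt {d : ℝ → ℝ} {c T : ℝ} (hd : ContinuousOn d (Ici T))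
    (hne : ∀ᶠ t in atTop, d t ≠ c) (hlt : ∃ᶠ t in atTop, d t < c) :
    ∀ᶠ t in atTop, d t < c := by
  obtain ⟨N, hN⟩ := eventually_atTop.1 hne
  obtain ⟨t, ht, htc⟩ := frequently_atTop.1 hlt (max N T)
  filter_upwards [eventually_ge_atTop t] with s hs
  by_contra! hcon
  obtain ⟨q, hq, hqc⟩ := intermediate_value_Icc hs
    (hd.mono fun q hq => ((le_max_right _ _).trans ht).trans hq.1) ⟨htc.le, hcon⟩
  exact hN q (((le_max_left _ _).trans ht).trans hq.1) hqc

theorem ae_frequently_notMem_of_tendsto_measure_zero {Ω : Type*} [MeasurableSpace Ω]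
    {μ : Measure Ω} {A : ℕ → Set Ω} (hA : Tendsto (fun n => μ (A n)) atTop (𝓝 0)) :
    ∀ᵐ α ∂μ, ∃ᶠ n in atTop, α ∉ A n := by
  have hnull : ∀ N : ℕ, μ (⋂ n ≥ N, A n) = 0 := fun N => by
    refine le_antisymm (ge_of_tendsto hA ?_) bot_le
    filter_upwards [eventually_ge_atTop N] with n hn
    exact measure_mono (iInter₂_subset n hn)
  have hae : ∀ᵐ α ∂μ, ∀ N : ℕ, α ∉ ⋂ n ≥ N, A n :=
    ae_all_iff.2 fun N => measure_eq_zero_iff_ae_notMem.1 (hnull N)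
  filter_upwards [hae] with α hα
  rw [frequently_atTop]
  intro N
  simpa using hα N

theorem hasDerivAt_max_zero_sq (s z : ℝ) :
    HasDerivAt (fun z => max (z - s) 0 ^ 2) (2 * max (z - s) 0) z := by
  have hne : ∀ q, q ≠ s → HasDerivAt (fun z => max (z - s) 0 ^ 2) (2 * max (q - s) 0) q := by
    intro q hq
    rcases lt_or_gt_of_ne hq with hlt | hgt
    · have hev : (fun z => max (z - s) 0 ^ 2) =ᶠ[𝓝 q] fun _ => 0 := by
        filter_upwards [gt_mem_nhds hlt] with x hx
        rw [max_eq_right (by linarith)]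
        simp
      rw [max_eq_right (by linarith), mul_zero]
      exact (hasDerivAt_const q 0).congr_of_eventuallyEq hev
    · have hev : (fun z => max (z - s) 0 ^ 2) =ᶠ[𝓝 q] fun z => (z - s) ^ 2 := by
        filter_upwards [lt_mem_nhds hgt] with x hx
        rw [max_eq_left (by linarith)]
      rw [max_eq_left (by linarith)]
      have hsq := ((hasDerivAt_id' q).sub_const s).fun_pow 2
      norm_num at hsq
      exact hsq.congr_of_eventuallyEq hev
  rcases eq_or_ne z s with rfl | hz
  · exact hasDerivAt_of_hasDerivAt_of_ne (g := fun q => 2 * max (q - z) 0) hne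
      (by fun_prop) (by fun_prop)
  · exact hne z hz

/-- A quadratic spline supported in the ball of radius `3h` around `z`, written as a combination of
convex functions. -/
noncomputable def splineBump (z h x : ℝ) : ℝ :=
  max (x - (z - 3 * h)) 0 ^ 2 - 3 * max (x - (z - h)) 0 ^ 2
    + 3 * max (x - (z + h)) 0 ^ 2 - max (x - (z + 3 * h)) 0 ^ 2

theorem splineBump_mem_Icc {z h : ℝ} (hh : 0 < h) (x : ℝ) :
    splineBump z h x ∈ Icc 0 (8 * h ^ 2) := by
  unfold splineBump
  rcases le_total x (z - 3 * h) with h1 | h1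
  · rw [max_eq_right (by linarith), max_eq_right (by linarith), max_eq_right (by linarith),
      max_eq_right (by linarith)]
    constructor <;> nlinarith
  rcases le_total x (z - h) with h2 | h2
  · rw [max_eq_left (by linarith), max_eq_right (by linarith), max_eq_right (by linarith),
      max_eq_right (by linarith)]
    constructor <;> nlinarith
  rcases le_total x (z + h) with h3 | h3
  · rw [max_eq_left (by linarith), max_eq_left (by linarith), max_eq_right (by linarith),
      max_eq_right (by linarith)]
    constructor <;> nlinarith [sq_nonneg (x - z)]
  rcases le_total x (z + 3 * h) with h4 | h4
  · rw [max_eq_left (by linarith), max_eq_left (by linarith), max_eq_left (by linarith),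
      max_eq_right (by linarith)]
    constructor <;> nlinarith [sq_nonneg (x - (z + 3 * h))]
  · rw [max_eq_left (by linarith), max_eq_left (by linarith), max_eq_left (by linarith),
      max_eq_left (by linarith)]
    constructor <;> nlinarith

theorem splineBump_eq_zero {z h x : ℝ} (hh : 0 < h) (hx : 3 * h ≤ |x - z|) :
    splineBump z h x = 0 := by
  unfold splineBump
  rcases le_abs.1 hx with h1 | h1
  · rw [max_eq_left (by linarith), max_eq_left (by linarith), max_eq_left (by linarith),
      max_eq_left (by linarith)]
    ring
  · rw [max_eq_right (by linarith), max_eq_right (by linarith), max_eq_right (by linarith),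
      max_eq_right (by linarith)]
    ring

theorem le_splineBump {z h x : ℝ} (hx : |x - z| ≤ h) : 4 * h ^ 2 ≤ splineBump z h x := by
  unfold splineBump
  obtain ⟨h1, h2⟩ := abs_le.1 hx
  rw [max_eq_left (by linarith), max_eq_left (by linarith), max_eq_right (by linarith),
    max_eq_right (by linarith)]
  nlinarith

theorem finite_of_pairwise_separated {S : Set ℝ} {r : ℝ} (hr : 0 < r) (hS : S ⊆ Icc 0 1)
    (hsep : ∀ a ∈ S, ∀ b ∈ S, a ≠ b → r ≤ |a - b|) : S.Finite := by
  refine Set.Finite.of_injOn (f := fun a => ⌊a / r⌋) (t := Icc ⌊0 / r⌋ ⌊1 / r⌋) ?_ ?_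
    (finite_Icc _ _)
  · intro a ha
    exact ⟨Int.floor_le_floor (by have := (hS ha).1; gcongr),
      Int.floor_le_floor (by have := (hS ha).2; gcongr)⟩
  · intro a ha b hb hab
    by_contra hne
    have hlt := Int.abs_sub_lt_one_of_floor_eq_floor hab
    rw [← sub_div, abs_div, abs_of_pos hr, div_lt_one hr] at hlt
    exact absurd (hsep a ha b hb hne) (not_le.2 hlt)

/-- The velocity of agent `α` at time `t` under the interaction kernel `ω`. -/
noncomputable def flowField {Ω : Type*} [MeasurableSpace Ω] (μ : Measure Ω)
    (ω : ℝ → Ω → Ω → ℝ) (y : ℝ → Ω → ℝ) (t : ℝ) (α : Ω) : ℝ :=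
  ∫ β, ω t α β * (y t β - y t α) ∂μ

/-- Opinion dynamics on an arbitrary space of agents, driven by a symmetric, bounded kernel. -/
structure SymmetricFlow {Ω : Type*} [MeasurableSpace Ω] (μ : Measure Ω) (W : ℝ)
    (ω : ℝ → Ω → Ω → ℝ) (y : ℝ → Ω → ℝ) : Prop where
  measurable : Measurable (Function.uncurry y)
  measurable_kernel : Measurable fun p : ℝ × Ω × Ω => ω p.1 p.2.1 p.2.2
  nonneg : ∀ t α β, 0 ≤ ω t α β
  le_bound : ∀ t α β, ω t α β ≤ W
  symm : ∀ t α β, ω t α β = ω t β α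
  init_mem : ∀ α, y 0 α ∈ Icc (0:ℝ) 1
  locBdd : ∀ T, ∃ M : ℝ, ∀ t ≤ T, ∀ α, |y t α| ≤ M
  absCont : ∀ α T, 0 ≤ T → AbsolutelyContinuousOnInterval (fun t => y t α) 0 T
  ode : ∀ α, ∀ᵐ t, 0 ≤ t → HasDerivAt (fun s => y s α) (flowField μ ω y t α) t

namespace SymmetricFlow

variable {Ω : Type*} [MeasurableSpace Ω] {μ : Measure Ω} {W : ℝ}
  {ω : ℝ → Ω → Ω → ℝ} {y : ℝ → Ω → ℝ}

theorem measurable_apply (h : SymmetricFlow μ W ω y) (t : ℝ) : Measurable (y t) :=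
  h.measurable.comp measurable_prodMk_left

theorem measurable_path (h : SymmetricFlow μ W ω y) (α : Ω) : Measurable fun t => y t α :=
  h.measurable.comp measurable_prodMk_right

theorem measurable_pair_fst (h : SymmetricFlow μ W ω y) :
    Measurable fun p : ℝ × Ω × Ω => y p.1 p.2.1 :=
  h.measurable.comp (measurable_fst.prodMk measurable_snd.fst)

theorem measurable_pair_snd (h : SymmetricFlow μ W ω y) :
    Measurable fun p : ℝ × Ω × Ω => y p.1 p.2.2 :=
  h.measurable.comp (measurable_fst.prodMk measurable_snd.snd)

theorem continuousOn_path (h : SymmetricFlow μ W ω y) (α : Ω) :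
    ContinuousOn (fun t => y t α) (Ici 0) :=
  continuousOn_Ici_of_absolutelyContinuousOnInterval (h.absCont α)

theorem absCont_Icc (h : SymmetricFlow μ W ω y) (α : Ω) {s t : ℝ} (hs : 0 ≤ s) (hst : s ≤ t) :
    AbsolutelyContinuousOnInterval (fun t => y t α) s t :=
  (h.absCont α t (hs.trans hst)).mono (by
    rw [uIcc_of_le hst, uIcc_of_le (hs.trans hst)]; exact Icc_subset_Icc_left hs)

theorem ode_Icc (h : SymmetricFlow μ W ω y) (α : Ω) {s t : ℝ} (hs : 0 ≤ s) :
    ∀ᵐ q, q ∈ Icc s t → HasDerivAt (fun t => y t α) (flowField μ ω y q α) q :=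
  (h.ode α).mono fun _ hq hmem => hq (hs.trans hmem.1)

/-- The rate at which the second moment of the opinions decreases. -/
noncomputable def dissipation (μ : Measure Ω) (ω : ℝ → Ω → Ω → ℝ) (y : ℝ → Ω → ℝ) (t : ℝ) : ℝ :=
  ∫ p : Ω × Ω, ω t p.1 p.2 * (y t p.2 - y t p.1) ^ 2 ∂(μ.prod μ)

theorem dissipation_nonneg (h : SymmetricFlow μ W ω y) (t : ℝ) : 0 ≤ dissipation μ ω y t :=
  integral_nonneg fun _ => mul_nonneg (h.nonneg _ _ _) (sq_nonneg _)

variable [IsProbabilityMeasure μ]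

theorem kernel_bound_nonneg (h : SymmetricFlow μ W ω y) : 0 ≤ W := by
  obtain ⟨α⟩ := nonempty_of_isProbabilityMeasure μ
  exact (h.nonneg 0 α α).trans (h.le_bound 0 α α)

theorem measurable_flowField (h : SymmetricFlow μ W ω y) :
    Measurable fun p : ℝ × Ω => flowField μ ω y p.1 p.2 := by
  have hm : Measurable fun q : (ℝ × Ω) × Ω => ω q.1.1 q.1.2 q.2 * (y q.1.1 q.2 - y q.1.1 q.1.2) :=
    (h.measurable_kernel.mul (h.measurable_pair_snd.sub h.measurable_pair_fst)).comp
      MeasurableEquiv.prodAssoc.measurable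
  exact (hm.stronglyMeasurable.integral_prod_right (ν := μ)
    (f := fun (p : ℝ × Ω) β => ω p.1 p.2 β * (y p.1 β - y p.1 p.2))).measurable

theorem abs_flowField_le (h : SymmetricFlow μ W ω y) {t C : ℝ} {α : Ω}
    (hC : ∀ᵐ β ∂μ, |y t β - y t α| ≤ C) : |flowField μ ω y t α| ≤ W * C := by
  have := norm_integral_le_of_norm_le_const (μ := μ)
    (f := fun β => ω t α β * (y t β - y t α)) (C := W * C) (by
      filter_upwards [hC] with β hβ
      rw [norm_mul, Real.norm_eq_abs, Real.norm_eq_abs, abs_of_nonneg (h.nonneg t α β)]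
      exact mul_le_mul (h.le_bound t α β) hβ (abs_nonneg _) h.kernel_bound_nonneg)
  simpa [flowField] using this

theorem exists_bound (h : SymmetricFlow μ W ω y) (T : ℝ) :
    ∃ C, ∀ t ≤ T, ∀ α, |y t α| ≤ C ∧ |flowField μ ω y t α| ≤ W * (2 * C) := by
  obtain ⟨M, hM⟩ := h.locBdd T
  refine ⟨M, fun t ht α => ⟨hM t ht α, h.abs_flowField_le (ae_of_all _ fun β => ?_)⟩⟩
  have h1 := abs_sub (y t β) (y t α)
  linarith [hM t ht α, hM t ht β]

theorem integrable_comp (h : SymmetricFlow μ W ω y) {f : ℝ → ℝ} (hf : Continuous f) (t : ℝ) :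
    Integrable (fun α => f (y t α)) μ := by
  obtain ⟨M, hM⟩ := h.locBdd t
  obtain ⟨K, hK⟩ := isCompact_Icc.exists_bound_of_continuousOn (hf.continuousOn (s := Icc (-M) M))
  exact Integrable.of_bound (hf.measurable.comp (h.measurable_apply t)).aestronglyMeasurable K
    (ae_of_all _ fun α => hK _ (abs_le.1 (hM t le_rfl α)))

theorem integral_comp_sub (h : SymmetricFlow μ W ω y) {f g : ℝ → ℝ}
    (hf : ∀ z, HasDerivAt f (g z) z) (hg : Continuous g) {s t : ℝ} (hs : 0 ≤ s) (hst : s ≤ t) :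
    ∫ α, f (y t α) ∂μ - ∫ α, f (y s α) ∂μ
      = ∫ q in s..t, ∫ α, g (y q α) * flowField μ ω y q α ∂μ := by
  have hfc : Continuous f := continuous_iff_continuousAt.2 fun z => (hf z).continuousAt
  obtain ⟨C, hC⟩ := h.exists_bound t
  obtain ⟨K, hK⟩ := isCompact_Icc.exists_bound_of_continuousOn (hg.continuousOn (s := Icc (-C) C))
  rw [← integral_sub (h.integrable_comp hfc t) (h.integrable_comp hfc s)]
  have hpt : ∀ α, f (y t α) - f (y s α) = ∫ q in Ioc s t, g (y q α) * flowField μ ω y q α :=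
    fun α => by
      rw [← intervalIntegral.integral_of_le hst]
      exact ((h.absCont_Icc α hs hst).integral_comp_eq_sub_of_ae_hasDerivAt hst (h.ode_Icc α hs)
        (fun q hq => (hC q hq.2 α).2) hf hg).symm
  simp_rw [hpt]
  rw [intervalIntegral.integral_of_le hst]
  apply integral_integral_swap
  have hmeas : Measurable fun p : Ω × ℝ => g (y p.2 p.1) * flowField μ ω y p.2 p.1 :=
    ((hg.measurable.comp h.measurable).mul h.measurable_flowField).comp measurable_swap
  refine Integrable.of_bound hmeas.aestronglyMeasurable (K * (W * (2 * C))) ?_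
  have hae : ∀ᵐ p : Ω × ℝ ∂(μ.prod (volume.restrict (Ioc s t))), p.2 ∈ Ioc s t :=
    Measure.quasiMeasurePreserving_snd.ae (ae_restrict_mem measurableSet_Ioc)
  filter_upwards [hae] with p hp
  have hb := hC p.2 hp.2 p.1
  have hk := hK _ (abs_le.1 hb.1)
  simp only [Function.uncurry, norm_mul]
  exact mul_le_mul hk hb.2 (norm_nonneg _) ((norm_nonneg _).trans hk)

theorem integrable_prod (h : SymmetricFlow μ W ω y) {k : ℝ → ℝ → ℝ}
    (hk : Continuous (Function.uncurry k)) (t : ℝ) :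
    Integrable (fun p : Ω × Ω => ω t p.1 p.2 * k (y t p.1) (y t p.2)) (μ.prod μ) := by
  obtain ⟨M, hM⟩ := h.locBdd t
  obtain ⟨K, hK⟩ := (isCompact_Icc.prod isCompact_Icc).exists_bound_of_continuousOn
    (hk.continuousOn (s := Icc (-M) M ×ˢ Icc (-M) M))
  have hmy : Measurable fun p : Ω × Ω => (y t p.1, y t p.2) :=
    ((h.measurable_apply t).comp measurable_fst).prodMk
      ((h.measurable_apply t).comp measurable_snd)
  have hmeas : Measurable fun p : Ω × Ω => ω t p.1 p.2 * k (y t p.1) (y t p.2) :=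
    (h.measurable_kernel.comp measurable_prodMk_left).mul (hk.measurable.comp hmy)
  refine Integrable.of_bound hmeas.aestronglyMeasurable (W * K) (ae_of_all _ fun p => ?_)
  rw [norm_mul, Real.norm_of_nonneg (h.nonneg _ _ _)]
  exact mul_le_mul (h.le_bound _ _ _)
    (hK (y t p.1, y t p.2) ⟨abs_le.1 (hM t le_rfl p.1), abs_le.1 (hM t le_rfl p.2)⟩)
    (norm_nonneg _) h.kernel_bound_nonneg

theorem integral_mul_flowField (h : SymmetricFlow μ W ω y) {g : ℝ → ℝ} (hg : Continuous g)
    (t : ℝ) :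
    ∫ α, g (y t α) * flowField μ ω y t α ∂μ = -(1 / 2) * ∫ p : Ω × Ω,
      ω t p.1 p.2 * ((g (y t p.2) - g (y t p.1)) * (y t p.2 - y t p.1)) ∂(μ.prod μ) := by
  have hint := h.integrable_prod (k := fun a b => g a * (b - a)) (by fun_prop) t
  have hint' := h.integrable_prod (k := fun a b => -(g b * (b - a))) (by fun_prop) t
  have h1 : ∫ α, g (y t α) * flowField μ ω y t α ∂μ
      = ∫ p : Ω × Ω, ω t p.1 p.2 * (g (y t p.1) * (y t p.2 - y t p.1)) ∂(μ.prod μ) := by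
    rw [integral_prod _ hint]
    refine integral_congr_ae (ae_of_all _ fun α => ?_)
    simp only [flowField]
    rw [← integral_const_mul]
    exact integral_congr_ae (ae_of_all _ fun β => by ring)
  have h2 : ∫ p : Ω × Ω, ω t p.1 p.2 * (g (y t p.1) * (y t p.2 - y t p.1)) ∂(μ.prod μ)
      = ∫ p : Ω × Ω, ω t p.1 p.2 * (-(g (y t p.2) * (y t p.2 - y t p.1))) ∂(μ.prod μ) := by
    rw [← integral_prod_swap]
    refine integral_congr_ae (ae_of_all _ fun p => ?_)
    simp only [Prod.fst_swap, Prod.snd_swap]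
    rw [h.symm t p.2 p.1]
    ring
  have h3 : ∫ p : Ω × Ω,
      ω t p.1 p.2 * ((g (y t p.2) - g (y t p.1)) * (y t p.2 - y t p.1)) ∂(μ.prod μ)
      = -(∫ p : Ω × Ω, ω t p.1 p.2 * (g (y t p.1) * (y t p.2 - y t p.1)) ∂(μ.prod μ)
        + ∫ p : Ω × Ω, ω t p.1 p.2 * (-(g (y t p.2) * (y t p.2 - y t p.1))) ∂(μ.prod μ)) := by
    rw [← integral_add hint hint', ← integral_neg]
    exact integral_congr_ae (ae_of_all _ fun p => by ring)
  rw [h3, ← h2, h1]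
  ring

theorem integral_comp_antitoneOn (h : SymmetricFlow μ W ω y) {f g : ℝ → ℝ}
    (hf : ∀ z, HasDerivAt f (g z) z) (hg : Continuous g) (hmono : Monotone g) :
    AntitoneOn (fun t => ∫ α, f (y t α) ∂μ) (Ici 0) := by
  intro s hs t ht hst
  have key := h.integral_comp_sub hf hg hs hst
  have hle : ∫ q in s..t, ∫ α, g (y q α) * flowField μ ω y q α ∂μ ≤ 0 := by
    rw [intervalIntegral.integral_of_le hst]
    refine integral_nonpos fun q => ?_
    simp only [Pi.zero_apply]
    rw [h.integral_mul_flowField hg]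
    have : 0 ≤ ∫ p : Ω × Ω,
        ω q p.1 p.2 * ((g (y q p.2) - g (y q p.1)) * (y q p.2 - y q p.1)) ∂(μ.prod μ) := by
      refine integral_nonneg fun p => mul_nonneg (h.nonneg _ _ _) ?_
      rcases le_total (y q p.1) (y q p.2) with hle | hle
      · exact mul_nonneg (sub_nonneg.2 (hmono hle)) (sub_nonneg.2 hle)
      · exact mul_nonneg_of_nonpos_of_nonpos (sub_nonpos.2 (hmono hle)) (sub_nonpos.2 hle)
    linarith
  simp only
  linarith

theorem tendsto_integral_comp (h : SymmetricFlow μ W ω y) {f g : ℝ → ℝ}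
    (hf : ∀ z, HasDerivAt f (g z) z) (hg : Continuous g) (hmono : Monotone g)
    (hnonneg : ∀ z, 0 ≤ f z) :
    ∃ l, Tendsto (fun t => ∫ α, f (y t α) ∂μ) atTop (𝓝 l) := by
  have hanti : Antitone fun t => ∫ α, f (y (max t 0) α) ∂μ := fun s t hst =>
    h.integral_comp_antitoneOn hf hg hmono (le_max_right s 0) (le_max_right t 0)
      (max_le_max_right 0 hst)
  have hbdd : BddBelow (range fun t => ∫ α, f (y (max t 0) α) ∂μ) :=
    ⟨0, by rintro _ ⟨t, rfl⟩; exact integral_nonneg fun α => hnonneg _⟩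
  refine ⟨_, (tendsto_atTop_ciInf hanti hbdd).congr' ?_⟩
  filter_upwards [eventually_ge_atTop 0] with t ht
  rw [max_eq_left ht]

theorem measurable_dissipation (h : SymmetricFlow μ W ω y) : Measurable (dissipation μ ω y) := by
  have hm : Measurable fun q : ℝ × Ω × Ω => ω q.1 q.2.1 q.2.2 * (y q.1 q.2.2 - y q.1 q.2.1) ^ 2 :=
    h.measurable_kernel.mul ((h.measurable_pair_snd.sub h.measurable_pair_fst).pow_const 2)
  exact (hm.stronglyMeasurable.integral_prod_right (ν := μ.prod μ)
    (f := fun t p => ω t p.1 p.2 * (y t p.2 - y t p.1) ^ 2)).measurable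

theorem integral_dissipation (h : SymmetricFlow μ W ω y) {T : ℝ} (hT : 0 ≤ T) :
    ∫ t in (0:ℝ)..T, dissipation μ ω y t = ∫ α, y 0 α ^ 2 ∂μ - ∫ α, y T α ^ 2 ∂μ := by
  have key := h.integral_comp_sub (f := fun z => z ^ 2) (g := fun z => 2 * z)
    (fun z => by simpa using hasDerivAt_pow 2 z) (by fun_prop) le_rfl hT
  have heq : ∀ q, ∫ α, 2 * y q α * flowField μ ω y q α ∂μ = -dissipation μ ω y q := fun q => by
    rw [h.integral_mul_flowField (g := fun z => 2 * z) (by fun_prop), dissipation,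
      ← integral_const_mul, ← integral_neg]
    exact integral_congr_ae (ae_of_all _ fun p => by ring)
  simp_rw [heq] at key
  rw [intervalIntegral.integral_neg] at key
  linarith

theorem integrableOn_dissipation (h : SymmetricFlow μ W ω y) :
    IntegrableOn (dissipation μ ω y) (Ioi 0) := by
  have hint : ∀ n : ℕ, IntegrableOn (dissipation μ ω y) (Ioc 0 (n : ℝ)) := fun n => by
    obtain ⟨M, hM⟩ := h.locBdd n
    refine Measure.integrableOn_of_bounded (M := W * (2 * M) ^ 2) (by simp)
      h.measurable_dissipation.aestronglyMeasurable ?_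
    filter_upwards [ae_restrict_mem measurableSet_Ioc] with t ht
    refine (norm_integral_le_of_norm_le_const (C := W * (2 * M) ^ 2)
      (ae_of_all _ fun p => ?_)).trans (by simp)
    rw [norm_mul, Real.norm_of_nonneg (h.nonneg _ _ _), Real.norm_of_nonneg (sq_nonneg _)]
    refine mul_le_mul (h.le_bound _ _ _) ?_ (sq_nonneg _) h.kernel_bound_nonneg
    have h1 := abs_sub (y t p.2) (y t p.1)
    rw [← sq_abs (y t p.2 - y t p.1)]
    gcongr
    linarith [hM t ht.2 p.1, hM t ht.2 p.2]
  refine integrableOn_Ioi_of_intervalIntegral_norm_bounded (∫ α, y 0 α ^ 2 ∂μ) 0 hint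
    tendsto_natCast_atTop_atTop (Eventually.of_forall fun n => ?_)
  simp_rw [Real.norm_of_nonneg (h.dissipation_nonneg _)]
  rw [h.integral_dissipation n.cast_nonneg]
  have : 0 ≤ ∫ α, y n α ^ 2 ∂μ := integral_nonneg fun α => sq_nonneg _
  linarith

theorem le_dissipation (h : SymmetricFlow μ W ω y) {r Δ δ : ℝ}
    (hω : ∀ t α β, |y t α - y t β| ≤ r → Δ ≤ ω t α β) (hδ : 0 ≤ δ) {A B : Set ℝ}
    (hA : MeasurableSet A) (hB : MeasurableSet B)
    (hAB : ∀ a ∈ A, ∀ b ∈ B, |a - b| ≤ r ∧ δ ≤ |a - b|) (t : ℝ) :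
    Δ * δ ^ 2 * (μ.real (y t ⁻¹' A) * μ.real (y t ⁻¹' B)) ≤ dissipation μ ω y t := by
  have hm : MeasurableSet ((y t ⁻¹' A) ×ˢ (y t ⁻¹' B)) :=
    (h.measurable_apply t hA).prod (h.measurable_apply t hB)
  have hint := h.integrable_prod (k := fun a b => (b - a) ^ 2) (by fun_prop) t
  calc Δ * δ ^ 2 * (μ.real (y t ⁻¹' A) * μ.real (y t ⁻¹' B))
      = ∫ p in (y t ⁻¹' A) ×ˢ (y t ⁻¹' B), Δ * δ ^ 2 ∂(μ.prod μ) := by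
        rw [setIntegral_const, measureReal_prod_prod, smul_eq_mul]; ring
    _ ≤ ∫ p in (y t ⁻¹' A) ×ˢ (y t ⁻¹' B), ω t p.1 p.2 * (y t p.2 - y t p.1) ^ 2 ∂(μ.prod μ) := by
        refine setIntegral_mono_on (integrable_const _).integrableOn hint.integrableOn hm fun p hp => ?_
        obtain ⟨h1, h2⟩ := hAB _ hp.1 _ hp.2
        have hnn := h.nonneg t p.1 p.2
        rw [← sq_abs (y t p.2 - y t p.1), abs_sub_comm (y t p.2)]
        gcongr
        exact hω _ _ _ h1
    _ ≤ dissipation μ ω y t :=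
        setIntegral_le_integral hint (ae_of_all _ fun p => mul_nonneg (h.nonneg _ _ _) (sq_nonneg _))

theorem ae_comp_eq_zero (h : SymmetricFlow μ W ω y) {f g : ℝ → ℝ}
    (hf : ∀ z, HasDerivAt f (g z) z) (hg : Continuous g) (hmono : Monotone g)
    (hnonneg : ∀ z, 0 ≤ f z) (hzero : ∀ z ∈ Icc (0:ℝ) 1, f z = 0) {t : ℝ} (ht : 0 ≤ t) :
    ∀ᵐ α ∂μ, f (y t α) = 0 := by
  have hfc : Continuous f := continuous_iff_continuousAt.2 fun z => (hf z).continuousAt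
  have hle := h.integral_comp_antitoneOn hf hg hmono (mem_Ici.2 le_rfl) (mem_Ici.2 ht) ht
  simp only [hzero _ (h.init_mem _), integral_zero] at hle
  exact (integral_eq_zero_iff_of_nonneg (fun α => hnonneg _) (h.integrable_comp hfc t)).1
    (le_antisymm hle (integral_nonneg fun α => hnonneg _))

theorem ae_mem_Icc (h : SymmetricFlow μ W ω y) {t : ℝ} (ht : 0 ≤ t) :
    ∀ᵐ α ∂μ, y t α ∈ Icc (0:ℝ) 1 := by
  have hup := h.ae_comp_eq_zero (hasDerivAt_max_zero_sq 1) (by fun_prop)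
    (fun a b hab => by dsimp only; gcongr) (fun z => sq_nonneg _)
    (fun z hz => by rw [max_eq_right (by linarith [hz.2])]; simp) ht
  have hlow := h.ae_comp_eq_zero (f := fun z => max (-z - 0) 0 ^ 2)
    (g := fun z => 2 * max (-z - 0) 0 * -1)
    (fun z => (hasDerivAt_max_zero_sq 0 (-z)).comp z (hasDerivAt_neg z)) (by fun_prop)
    (fun a b hab => by
      have : max (-b - 0) 0 ≤ max (-a - 0) 0 := by gcongr
      dsimp only; linarith) (fun z => sq_nonneg _)
    (fun z hz => by rw [max_eq_right (by linarith [hz.1])]; simp) ht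
  filter_upwards [hup, hlow] with α h1 h2
  rw [sq_eq_zero_iff, max_eq_right_iff] at h1 h2
  exact ⟨by linarith, by linarith⟩

theorem ae_forall_mem_Icc (h : SymmetricFlow μ W ω y) :
    ∀ᵐ α ∂μ, ∀ t, 0 ≤ t → y t α ∈ Icc (0:ℝ) 1 := by
  have hrat : ∀ᵐ α ∂μ, ∀ q : ℚ, y |(q:ℝ)| α ∈ Icc (0:ℝ) 1 :=
    ae_all_iff.2 fun q => h.ae_mem_Icc (abs_nonneg _)
  filter_upwards [hrat] with α hα t ht
  have hcont : Continuous fun t : ℝ => y |t| α :=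
    (h.continuousOn_path α).comp_continuous continuous_abs fun t => abs_nonneg t
  have := Rat.denseRange_cast (𝕜 := ℝ) |>.induction_on (p := fun t => y |t| α ∈ Icc (0:ℝ) 1) t
    (isClosed_Icc.preimage hcont) hα
  rwa [abs_of_nonneg ht] at this

theorem ae_lipschitz (h : SymmetricFlow μ W ω y) :
    ∀ᵐ α ∂μ, ∀ s t, 0 ≤ s → s ≤ t → |y t α - y s α| ≤ W * (t - s) := by
  filter_upwards [h.ae_forall_mem_Icc] with α hα s t hs hst
  refine (h.absCont_Icc α hs hst).abs_sub_le_of_ae_hasDerivAt hst (h.ode_Icc α hs) fun q hq => ?_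
  rw [← mul_one W]
  refine h.abs_flowField_le ?_
  filter_upwards [h.ae_mem_Icc (hs.trans hq.1)] with β hβ
  obtain ⟨h1, h2⟩ := hα q (hs.trans hq.1)
  exact abs_le.2 ⟨by linarith [hβ.1], by linarith [hβ.2]⟩

theorem tendsto_integral_splineBump (h : SymmetricFlow μ W ω y) (z ε : ℝ) :
    ∃ l, Tendsto (fun t => ∫ α, splineBump z ε (y t α) ∂μ) atTop (𝓝 l) := by
  have hp : ∀ s, ∃ l, Tendsto (fun t => ∫ α, max (y t α - s) 0 ^ 2 ∂μ) atTop (𝓝 l) := fun s =>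
    h.tendsto_integral_comp (hasDerivAt_max_zero_sq s) (by fun_prop)
      (fun a b hab => by dsimp only; gcongr) (fun z => sq_nonneg _)
  have hi : ∀ s t, Integrable (fun α => max (y t α - s) 0 ^ 2) μ := fun s t =>
    h.integrable_comp (f := fun x => max (x - s) 0 ^ 2) (by fun_prop) t
  choose l hl using hp
  refine ⟨_, ((((hl (z - 3 * ε)).sub ((hl (z - ε)).const_mul 3)).add
    ((hl (z + ε)).const_mul 3)).sub (hl (z + 3 * ε))).congr fun t => ?_⟩
  unfold splineBump
  rw [integral_sub, integral_add, integral_sub, integral_const_mul, integral_const_mul]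
  all_goals
    first
    | exact hi _ _
    | exact (hi _ _).const_mul 3
    | exact (hi _ _).sub ((hi _ _).const_mul 3)
    | exact ((hi _ _).sub ((hi _ _).const_mul 3)).add ((hi _ _).const_mul 3)

/-- A point every neighbourhood of which retains a positive mass of opinions. -/
def IsCluster (μ : Measure Ω) (y : ℝ → Ω → ℝ) (z : ℝ) : Prop :=
  ∀ ε > 0, ∃ c > 0, ∀ᶠ t in atTop, c ≤ μ.real (y t ⁻¹' Metric.ball z ε)

theorem isCluster_or_tendsto (h : SymmetricFlow μ W ω y) (z : ℝ) :
    IsCluster μ y z ∨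
      ∃ ε > 0, Tendsto (fun t => μ (y t ⁻¹' Metric.ball z ε)) atTop (𝓝 0) := by
  have hcont : ∀ ε, Continuous (splineBump z ε) := fun ε => by unfold splineBump; fun_prop
  have hball : ∀ ε t, MeasurableSet (y t ⁻¹' Metric.ball z ε) := fun ε t =>
    h.measurable_apply t measurableSet_ball
  by_cases H : ∃ ε > 0, Tendsto (fun t => ∫ α, splineBump z ε (y t α) ∂μ) atTop (𝓝 0)
  · right
    obtain ⟨ε, hε, hlim⟩ := H
    refine ⟨ε, hε, ?_⟩
    have hreal : Tendsto (fun t => μ.real (y t ⁻¹' Metric.ball z ε)) atTop (𝓝 0) := by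
      refine squeeze_zero (fun t => measureReal_nonneg)
        (g := fun t => (4 * ε ^ 2)⁻¹ * ∫ α, splineBump z ε (y t α) ∂μ) (fun t => ?_)
        (by simpa only [mul_zero] using hlim.const_mul (4 * ε ^ 2)⁻¹)
      rw [← div_eq_inv_mul, le_div_iff₀ (by positivity)]
      calc μ.real (y t ⁻¹' Metric.ball z ε) * (4 * ε ^ 2)
          = ∫ α, (y t ⁻¹' Metric.ball z ε).indicator (fun _ => 4 * ε ^ 2) α ∂μ := by
            rw [integral_indicator_const _ (hball ε t), smul_eq_mul]
        _ ≤ _ := by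
            refine integral_mono ((integrable_const _).indicator (hball ε t))
              (h.integrable_comp (hcont ε) t) fun α => ?_
            by_cases hα : α ∈ y t ⁻¹' Metric.ball z ε
            · rw [indicator_of_mem hα]
              exact le_splineBump (le_of_lt hα)
            · rw [indicator_of_notMem hα]
              exact (splineBump_mem_Icc hε _).1
    rw [← ENNReal.tendsto_toReal_iff (fun t => measure_ne_top _ _) ENNReal.zero_ne_top]
    simpa [Measure.real] using hreal
  · left
    push Not at H
    intro ε hε
    have hε3 : 0 < ε / 3 := by positivity
    obtain ⟨l, hl⟩ := h.tendsto_integral_splineBump z (ε / 3)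
    have hl0 : 0 ≤ l :=
      ge_of_tendsto' hl fun t => integral_nonneg fun α => (splineBump_mem_Icc hε3 _).1
    have hlpos : 0 < l := lt_of_le_of_ne hl0 fun h0 => H _ hε3 (h0 ▸ hl)
    refine ⟨l / 2 / (8 * (ε / 3) ^ 2), by positivity, ?_⟩
    filter_upwards [hl.eventually (lt_mem_nhds (half_lt_self hlpos))] with t ht
    rw [div_le_iff₀ (by positivity)]
    refine ht.le.trans ?_
    calc ∫ α, splineBump z (ε / 3) (y t α) ∂μ
        ≤ ∫ α, (y t ⁻¹' Metric.ball z ε).indicator (fun _ => 8 * (ε / 3) ^ 2) α ∂μ := by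
          refine integral_mono (h.integrable_comp (hcont _) t)
            ((integrable_const _).indicator (hball ε t)) fun α => ?_
          by_cases hα : α ∈ y t ⁻¹' Metric.ball z ε
          · rw [indicator_of_mem hα]
            exact (splineBump_mem_Icc hε3 _).2
          · rw [indicator_of_notMem hα]
            refine (splineBump_eq_zero hε3 ?_).le
            have : ε ≤ |y t α - z| := not_lt.1 hα
            linarith
      _ = _ := by rw [integral_indicator_const _ (hball ε t), smul_eq_mul]

theorem IsCluster.mem_Icc (h : SymmetricFlow μ W ω y) {z : ℝ} (hz : IsCluster μ y z) :
    z ∈ Icc (0:ℝ) 1 := by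
  by_contra hcon
  obtain ⟨ε, hε, hball⟩ := Metric.isOpen_iff.1 isClosed_Icc.isOpen_compl z hcon
  obtain ⟨c, hc, hev⟩ := hz ε hε
  obtain ⟨t, htc, ht⟩ := (hev.and (eventually_ge_atTop 0)).exists
  have hnull : μ (y t ⁻¹' Metric.ball z ε) = 0 := by
    rw [measure_eq_zero_iff_ae_notMem]
    filter_upwards [h.ae_mem_Icc ht] with α hα hmem
    exact hball hmem hα
  rw [Measure.real, hnull, ENNReal.toReal_zero] at htc
  exact absurd hc (not_lt.2 htc)

theorem not_eventually_le_dissipation (h : SymmetricFlow μ W ω y) {κ : ℝ} (hκ : 0 < κ) :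
    ¬ ∀ᶠ t in atTop, κ ≤ dissipation μ ω y t := by
  intro hev
  obtain ⟨T, hT⟩ := eventually_atTop.1 (hev.and (eventually_ge_atTop 0))
  have hint : IntegrableOn (fun _ : ℝ => κ) (Ioi T) := by
    refine Integrable.mono' (h.integrableOn_dissipation.mono_set (Ioi_subset_Ioi (hT T le_rfl).2))
      aestronglyMeasurable_const ?_
    filter_upwards [ae_restrict_mem measurableSet_Ioi] with t ht
    rw [Real.norm_of_nonneg hκ.le]
    exact (hT t (le_of_lt ht)).1
  simp [integrableOn_const_iff, hκ.ne'] at hint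

theorem IsCluster.le_abs_sub (h : SymmetricFlow μ W ω y) {r Δ : ℝ} (hΔ : 0 < Δ)
    (hω : ∀ t α β, |y t α - y t β| ≤ r → Δ ≤ ω t α β) {a b : ℝ} (ha : IsCluster μ y a)
    (hb : IsCluster μ y b) (hab : a ≠ b) : r ≤ |a - b| := by
  by_contra! hlt
  set d := |a - b| with hd
  have hdpos : 0 < d := abs_pos.2 (sub_ne_zero.2 hab)
  obtain ⟨ε, hε, hεd, hεr⟩ : ∃ ε > 0, ε ≤ d / 4 ∧ ε ≤ (r - d) / 2 :=
    ⟨min (d / 4) ((r - d) / 2), lt_min (by positivity) (by linarith), min_le_left _ _,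
      min_le_right _ _⟩
  obtain ⟨c, hc, hca⟩ := ha ε hε
  obtain ⟨c', hc', hcb⟩ := hb ε hε
  refine h.not_eventually_le_dissipation (κ := Δ * (d / 2) ^ 2 * (c * c')) (by positivity) ?_
  filter_upwards [hca, hcb] with t h1 h2
  refine le_trans ?_ (h.le_dissipation hω (δ := d / 2) (by positivity)
    (measurableSet_ball (x := a) (ε := ε)) (measurableSet_ball (x := b) (ε := ε))
    (fun p hp q hq => ?_) t)
  · gcongr
  · rw [Metric.mem_ball, Real.dist_eq, abs_lt] at hp hq
    constructor
    · rw [abs_le]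
      constructor <;> linarith [le_abs_self (a - b), neg_abs_le (a - b)]
    · rcases abs_cases (a - b) with ⟨h3, -⟩ | ⟨h3, -⟩
      · exact le_trans (by linarith) (le_abs_self _)
      · exact le_trans (by linarith) (neg_le_abs _)

theorem tendsto_measure_of_isCompact (h : SymmetricFlow μ W ω y) {K : Set ℝ} (hK : IsCompact K)
    (hcl : ∀ z ∈ K, ¬ IsCluster μ y z) :
    Tendsto (fun t => μ (y t ⁻¹' K)) atTop (𝓝 0) := by
  refine hK.induction_on (p := fun K => Tendsto (fun t => μ (y t ⁻¹' K)) atTop (𝓝 0))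
    (by simp) ?_ ?_ ?_
  · intro s t hst ht
    exact tendsto_of_tendsto_of_tendsto_of_le_of_le tendsto_const_nhds ht (fun _ => bot_le)
      fun q => measure_mono (preimage_mono hst)
  · intro s t hs ht
    refine tendsto_of_tendsto_of_tendsto_of_le_of_le tendsto_const_nhds
      (by simpa using hs.add ht) (fun _ => bot_le) fun q => ?_
    rw [preimage_union]
    exact measure_union_le _ _
  · intro z hz
    obtain ⟨ε, hε, hlim⟩ := (h.isCluster_or_tendsto z).resolve_left (hcl z hz)
    exact ⟨_, mem_nhdsWithin_of_mem_nhds (Metric.ball_mem_nhds z hε), hlim⟩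

theorem exists_isCluster (h : SymmetricFlow μ W ω y) : ∃ z, IsCluster μ y z := by
  by_contra! hcon
  have hlim := h.tendsto_measure_of_isCompact (isCompact_Icc (a := (0:ℝ)) (b := 1))
    fun z _ => hcon z
  have hone : (fun _ : ℝ => (1 : ENNReal)) =ᶠ[atTop] fun t => μ (y t ⁻¹' Icc 0 1) := by
    filter_upwards [eventually_ge_atTop 0] with t ht
    exact ((mem_ae_iff_prob_eq_one (h.measurable_apply t measurableSet_Icc)).1 (h.ae_mem_Icc ht)).symm
  exact one_ne_zero (tendsto_nhds_unique (tendsto_const_nhds.congr' hone) hlim)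

theorem IsCluster.ae_eventually_ne (h : SymmetricFlow μ W ω y) {r Δ : ℝ} (hW : 0 < W)
    (hΔ : 0 < Δ) (hω : ∀ t α β, |y t α - y t β| ≤ r → Δ ≤ ω t α β) {z ε : ℝ}
    (hz : IsCluster μ y z) (hε : 0 < ε) (hεr : 3 * ε ≤ r) :
    ∀ᵐ α ∂μ, ∀ᶠ t in atTop, |y t α - z| ≠ 3 / 2 * ε := by
  set B : Set ℝ := {b | ε ≤ |b - z| ∧ |b - z| ≤ 2 * ε} with hB
  have hdist : Measurable fun b : ℝ => |b - z| := by fun_prop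
  have hBm : MeasurableSet B :=
    (measurableSet_le measurable_const hdist).inter (measurableSet_le hdist measurable_const)
  obtain ⟨c, hc, hev⟩ := hz (ε / 2) (by positivity)
  obtain ⟨T, hT⟩ := eventually_atTop.1 (hev.and (eventually_ge_atTop 0))
  have hT0 : 0 ≤ T := (hT T le_rfl).2
  have hEm : MeasurableSet (Function.uncurry y ⁻¹' B) := h.measurable hBm
  have hκ : 0 < Δ * (ε / 2) ^ 2 * c := by positivity
  have hbound : ∀ t ∈ Ioi T,
      μ (y t ⁻¹' B) ≤ ENNReal.ofReal ((Δ * (ε / 2) ^ 2 * c)⁻¹ * dissipation μ ω y t) := by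
    intro t ht
    rw [← ofReal_measureReal]
    refine ENNReal.ofReal_le_ofReal ?_
    rw [← div_eq_inv_mul, le_div_iff₀ hκ]
    refine le_trans ?_ (h.le_dissipation hω (δ := ε / 2) (by positivity)
      (measurableSet_ball (x := z) (ε := ε / 2)) hBm (fun p hp q hq => ?_) t)
    · have := (hT t (le_of_lt ht)).1
      calc μ.real (y t ⁻¹' B) * (Δ * (ε / 2) ^ 2 * c)
          = Δ * (ε / 2) ^ 2 * (c * μ.real (y t ⁻¹' B)) := by ring
        _ ≤ _ := by gcongr
    · rw [Metric.mem_ball, Real.dist_eq] at hp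
      have h1 := abs_sub_abs_le_abs_sub (q - z) (p - z)
      have h2 := abs_sub (q - z) (p - z)
      rw [sub_sub_sub_cancel_right, abs_sub_comm q p] at h1 h2
      exact ⟨by linarith [hq.2], by linarith [hq.1]⟩
  have hfin : ((volume.restrict (Ioi T)).prod μ) (Function.uncurry y ⁻¹' B) < ⊤ := by
    rw [Measure.prod_apply hEm]
    refine (setLIntegral_mono' measurableSet_Ioi hbound).trans_lt ?_
    exact ((h.integrableOn_dissipation.mono_set (Ioi_subset_Ioi hT0)).const_mul _).lintegral_lt_top
  rw [Measure.prod_apply_symm hEm] at hfin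
  have hae := ae_lt_top (measurable_measure_prodMk_right hEm) hfin.ne
  filter_upwards [hae, h.ae_lipschitz] with α hα hlip
  refine eventually_ne_of_volume_annulus_lt_top hε hW
    (fun s t hs hst => hlip s t (hT0.trans hs) hst) (h.measurable_path α) (T := T) ?_
  rwa [Measure.restrict_apply' measurableSet_Ioi] at hα

theorem ae_exists_tendsto (h : SymmetricFlow μ W ω y) {r Δ : ℝ} (hW : 0 < W) (hr : 0 < r)
    (hΔ : 0 < Δ) (hω : ∀ t α β, |y t α - y t β| ≤ r → Δ ≤ ω t α β)
    (hfin : {z | IsCluster μ y z}.Finite) :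
    ∀ᵐ α ∂μ, ∃ z, IsCluster μ y z ∧ Tendsto (fun t => y t α) atTop (𝓝 z) := by
  set S := {z | IsCluster μ y z} with hS
  set ε : ℕ → ℝ := fun n => r / 4 * (1 / ((n : ℝ) + 1)) with hεdef
  have hε : ∀ n, 0 < ε n := fun n => by positivity
  have hεr : ∀ n, ε n ≤ r / 4 := fun n => by
    have : 1 / ((n : ℝ) + 1) ≤ 1 := by
      rw [div_le_one (by positivity)]
      linarith [n.cast_nonneg (α := ℝ)]
    calc ε n ≤ r / 4 * 1 := by simp only [hεdef]; gcongr
      _ = r / 4 := mul_one _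
  have hne : ∀ᵐ α ∂μ, ∀ n, ∀ z ∈ S, ∀ᶠ t in atTop, |y t α - z| ≠ 3 / 2 * ε n :=
    ae_all_iff.2 fun n => (ae_ball_iff hfin.countable).2 fun z hz =>
      IsCluster.ae_eventually_ne h hW hΔ hω hz (hε n) (by linarith [hεr n])
  have hfreq : ∀ᵐ α ∂μ, ∀ n, ∃ᶠ k : ℕ in atTop,
      α ∉ y k ⁻¹' (Icc 0 1 \ ⋃ z ∈ S, Metric.ball z (ε n)) := by
    refine ae_all_iff.2 fun n => ae_frequently_notMem_of_tendsto_measure_zero ?_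
    refine (h.tendsto_measure_of_isCompact (isCompact_Icc.diff
      (isOpen_biUnion fun z _ => Metric.isOpen_ball)) fun z hz hcl => ?_).comp
      tendsto_natCast_atTop_atTop
    exact hz.2 (mem_biUnion hcl (Metric.mem_ball_self (hε n)))
  filter_upwards [h.ae_forall_mem_Icc, hne, hfreq] with α hmem hne hfreq
  have hclose : ∀ n, ∃ z ∈ S, ∀ᶠ t in atTop, |y t α - z| < 3 / 2 * ε n := by
    intro n
    have hex : ∃ z ∈ S, ∃ᶠ t in atTop, |y t α - z| < 3 / 2 * ε n := by
      by_contra! hcon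
      have hall : ∀ᶠ t in atTop, ∀ z ∈ S, ¬ |y t α - z| < 3 / 2 * ε n :=
        (eventually_all_finite hfin).2 fun z hz => (hcon z hz).mono fun _ => not_lt.2
      obtain ⟨k, hk, hk'⟩ :=
        ((hfreq n).and_eventually (tendsto_natCast_atTop_atTop.eventually hall)).exists
      refine hk ⟨hmem k k.cast_nonneg, fun hU => ?_⟩
      obtain ⟨z, hz, hzb⟩ := mem_iUnion₂.1 hU
      rw [Metric.mem_ball, Real.dist_eq] at hzb
      exact hk' z hz (by linarith [hε n])
    obtain ⟨z, hz, hzf⟩ := hex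
    exact ⟨z, hz, eventually_lt_of_frequently_lt (T := 0)
      ((h.continuousOn_path α).sub continuousOn_const).abs (hne n z hz) hzf⟩
  obtain ⟨z, hz, hzev⟩ := hclose 0
  refine ⟨z, hz, Metric.tendsto_nhds.2 fun e he => ?_⟩
  obtain ⟨n, hn⟩ := exists_nat_one_div_lt (K := ℝ) (show 0 < e / r by positivity)
  obtain ⟨z', hz', hzev'⟩ := hclose n
  have heq : z' = z := by
    by_contra hzz
    obtain ⟨t, ht, ht'⟩ := (hzev.and hzev').exists
    have hsep := IsCluster.le_abs_sub h hΔ hω hz' hz hzz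
    have htri := abs_sub_le z' (y t α) z
    rw [abs_sub_comm z' (y t α)] at htri
    linarith [hεr 0, hεr n]
  subst heq
  filter_upwards [hzev'] with t ht
  rw [Real.dist_eq]
  have hlt : ε n < e / 4 := by
    calc ε n < r / 4 * (e / r) := by simp only [hεdef]; gcongr
      _ = e / 4 := by field_simp
  linarith

end SymmetricFlow

theorem interactionField_eq_integral_unitInterval (w : ℝ → ℝ → ℝ → ℝ → ℝ → ℝ) (x : ℝ → ℝ → ℝ)
    (t α : ℝ) : interactionField w x t α
      = ∫ β : unitInterval, w t α β (x t α) (x t β) * (x t β - x t α) := by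
  rw [interactionField, intervalIntegral.integral_of_le zero_le_one, ← integral_Icc_eq_integral_Ioc]
  exact (integral_subtype measurableSet_Icc
    fun β => w t α β (x t α) (x t β) * (x t β - x t α)).symm

theorem IsSolution.symmetricFlow {W : ℝ} {w : ℝ → ℝ → ℝ → ℝ → ℝ → ℝ} {x : ℝ → ℝ → ℝ}
    (hw : IsWeight W w) (hsym : SymmetricWeight w) (hx : IsSolution w x) :
    SymmetricFlow (volume : Measure unitInterval) W
      (fun t α β => w (max t 0) α β (x (max t 0) α) (x (max t 0) β))
      (fun t α => x (max t 0) α) := by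
  have hac : ∀ (α : unitInterval) (T : ℝ), 0 ≤ T →
      AbsolutelyContinuousOnInterval (fun t => x t α) 0 T := fun α T hT =>
    (hx.absCont α α.2 T hT).absolutelyContinuousOnInterval hT
  have hcont : ∀ α : unitInterval, Continuous fun t => x (max t 0) α := fun α => by
    have hon := continuousOn_Ici_of_absolutelyContinuousOnInterval (hac α)
    exact hon.comp_continuous (by fun_prop) fun t => le_max_right t 0
  have hmeas : Measurable (Function.uncurry fun (t : ℝ) (α : unitInterval) => x (max t 0) α) :=
    measurable_uncurry_of_continuous_of_measurable hcont fun t =>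
      (hx.meas _ (le_max_right t 0)).comp measurable_subtype_coe
  have hev : ∀ (α : unitInterval) (T : ℝ), 0 ≤ T → ∀ t ∈ uIcc 0 T, x (max t 0) α = x t α := by
    intro α T hT t ht
    rw [uIcc_of_le hT] at ht
    rw [max_eq_left ht.1]
  refine ⟨hmeas, ?_, fun t α β => hw.nonneg _ (le_max_right t 0) _ α.2 _ β.2 _ _,
    fun t α β => hw.le_bound _ (le_max_right t 0) _ α.2 _ β.2 _ _, fun t α β => hsym _ _ _ _ _,
    fun α => ?_, fun T => ?_, fun α T hT => ?_, fun α => ?_⟩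
  · have h1 : Measurable fun p : ℝ × unitInterval × unitInterval => x (max p.1 0) p.2.1 :=
      hmeas.comp (measurable_fst.prodMk measurable_snd.fst)
    have h2 : Measurable fun p : ℝ × unitInterval × unitInterval => x (max p.1 0) p.2.2 :=
      hmeas.comp (measurable_fst.prodMk measurable_snd.snd)
    exact hw.measurable.comp ((measurable_fst.max measurable_const).prodMk
      ((measurable_subtype_coe.comp measurable_snd.fst).prodMk
        ((measurable_subtype_coe.comp measurable_snd.snd).prodMk (h1.prodMk h2))))
  · simpa using hx.init_mem α α.2
  · obtain ⟨M, hM⟩ := hx.locBdd (max T 0) (le_max_right T 0)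
    exact ⟨M, fun t ht α => hM α α.2 _ ⟨le_max_right t 0, max_le_max_right 0 ht⟩⟩
  · have h := hac α T hT
    rw [absolutelyContinuousOnInterval_iff] at h ⊢
    intro ε hε
    obtain ⟨δ, hδ, h⟩ := h ε hε
    refine ⟨δ, hδ, fun E hE hlen => ?_⟩
    refine (Finset.sum_congr rfl fun i hi => ?_).trans_lt (h E hE hlen)
    rw [hev α T hT _ (hE.1 i hi).1, hev α T hT _ (hE.1 i hi).2]
  · have hode := (ae_restrict_iff' measurableSet_Ici).1 (hx.ode α α.2)
    have hne : ∀ᵐ t : ℝ, t ≠ 0 := by simp [ae_iff]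
    filter_upwards [hode, hne] with t ht hne hnn
    have hpos : 0 < t := lt_of_le_of_ne hnn hne.symm
    have hd := ht hnn
    rw [interactionField_eq_integral_unitInterval] at hd
    simp only [flowField, max_eq_left hnn]
    refine hd.congr_of_eventuallyEq ?_
    filter_upwards [lt_mem_nhds hpos] with s hs
    rw [max_eq_left hs.le]

/-- If the weight function is symmetric and belongs to `Γ(r,Δ)` with
`r, Δ > 0`, then almost every agent's opinion converges, and the limits lie in a finite
set of points of `[0,1]` that are pairwise at distance at least `r`. -/
theorem ae_convergence_to_finitely_many_separated_points
    (W r Δ : ℝ) (hW : 0 < W) (hr : 0 < r) (hΔ : 0 < Δ)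
    (w : ℝ → ℝ → ℝ → ℝ → ℝ → ℝ) (x : ℝ → ℝ → ℝ)
    (hw : IsWeight W w) (hsym : SymmetricWeight w) (hΓ : InGamma r Δ w)
    (hx : IsSolution w x) :
    ∃ k : ℕ, 1 ≤ k ∧ ∃ z : Fin k → ℝ,
      (∀ i, z i ∈ Icc (0:ℝ) 1) ∧
      (∀ i j, i ≠ j → r ≤ |z i - z j|) ∧
      ∀ᵐ α ∂(volume.restrict (Icc (0:ℝ) 1)),
        ∃ i, Tendsto (fun t => x t α) atTop (𝓝 (z i)) := by
  have hflow := hx.symmetricFlow hw hsym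
  have hω : ∀ (t : ℝ) (α β : unitInterval), |x (max t 0) α - x (max t 0) β| ≤ r →
      Δ ≤ w (max t 0) α β (x (max t 0) α) (x (max t 0) β) := fun t α β =>
    hΓ _ (le_max_right t 0) _ α.2 _ β.2 _ _
  set S : Set ℝ := {z | SymmetricFlow.IsCluster (volume : Measure unitInterval)
    (fun t α => x (max t 0) α) z} with hS
  have hsep : ∀ a ∈ S, ∀ b ∈ S, a ≠ b → r ≤ |a - b| := fun a ha b hb hab =>
    SymmetricFlow.IsCluster.le_abs_sub hflow hΔ hω ha hb hab
  have hmem : S ⊆ Icc 0 1 := fun z hz => SymmetricFlow.IsCluster.mem_Icc hflow hz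
  have hfin : S.Finite := finite_of_pairwise_separated hr hmem hsep
  obtain ⟨k, z, hz_inj, hz_range⟩ := hfin.fin_param
  refine ⟨k, ?_, z, fun i => hmem (hz_range ▸ mem_range_self i), fun i j hij =>
    hsep _ (hz_range ▸ mem_range_self i) _ (hz_range ▸ mem_range_self j) (hz_inj.ne hij), ?_⟩
  · obtain ⟨q, hq⟩ := hflow.exists_isCluster
    have hqS : q ∈ range z := hz_range ▸ (show q ∈ S from hq)
    obtain ⟨i, -⟩ := hqS
    exact i.pos
  · rw [ae_restrict_iff_subtype measurableSet_Icc]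
    filter_upwards [hflow.ae_exists_tendsto hW hr hΔ hω hfin] with α hα
    obtain ⟨q, hq, hlim⟩ := hα
    have hqS : q ∈ range z := hz_range ▸ (show q ∈ S from hq)
    obtain ⟨i, rfl⟩ := hqS
    refine ⟨i, hlim.congr' ?_⟩
    filter_upwards [eventually_ge_atTop 0] with t ht
    rw [max_eq_left ht]
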